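/- Let A = exp(2πi·3/40) ∈ ℂ and let M be the 5 × 5 complex matrix M = A·[[0, A⁻⁶, 0, −1, A²], [A², −1+A⁻⁴, −1, 0, 0], [0, 0, 0, A⁻⁶−A⁻², 1], [0, 0, −A⁻², −1+A⁻⁴, A²], [0, 0, 0, −A², A⁴]]. Then M^n ≠ I₅ for every integer n ≥ 1; that is, M has infinite order in GL₅(ℂ). -/

import Mathlib

/-- The primitive `40`-th root of unity `A = exp(2πi·3/40)`. -/
noncomputable def AVal : ℂ := Complex.exp (2 * Real.pi * Complex.I * 3 / 40)

/-- The matrix of `η_A^{6,0}(σ₁σ₂σ₃⁻¹)`. -/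
noncomputable def MVal : Matrix (Fin 5) (Fin 5) ℂ :=
  AVal • !![0, AVal ^ (-6 : ℤ), 0, -1, AVal ^ 2;
            AVal ^ 2, -1 + AVal ^ (-4 : ℤ), -1, 0, 0;
            0, 0, 0, AVal ^ (-6 : ℤ) - AVal ^ (-2 : ℤ), 1;
            0, 0, -AVal ^ (-2 : ℤ), -1 + AVal ^ (-4 : ℤ), AVal ^ 2;
            0, 0, 0, -AVal ^ 2, AVal ^ 4]

/-- The trace of a complex matrix of finite order is bounded by its size. -/
lemma Matrix.norm_trace_le_card_of_pow_eq_one {ι : Type*} [Fintype ι] [DecidableEq ι]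
    {X : Matrix ι ι ℂ} {n : ℕ} (hn : n ≠ 0) (hX : X ^ n = 1) :
    ‖X.trace‖ ≤ Fintype.card ι := by
  cases isEmpty_or_nonempty ι
  · simp [Matrix.trace]
  have root_norm : ∀ x ∈ X.charpoly.roots, ‖x‖ = 1 := by
    intro x hx
    have hs : x ∈ spectrum ℂ X :=
      Matrix.mem_spectrum_of_isRoot_charpoly (Polynomial.isRoot_of_mem_roots hx)
    have hp := spectrum.pow_mem_pow X n hs
    rw [hX, spectrum.one_eq] at hp
    exact Complex.norm_eq_one_of_pow_eq_one hp hn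
  have hcard : X.charpoly.roots.card ≤ Fintype.card ι :=
    (Polynomial.card_roots' _).trans X.charpoly_natDegree_eq_dim.le
  rw [Matrix.trace_eq_sum_roots_charpoly]
  calc ‖X.charpoly.roots.sum‖ ≤ (X.charpoly.roots.map (fun x => ‖x‖)).sum :=
        norm_multiset_sum_le _
    _ = X.charpoly.roots.card := by
        rw [Multiset.map_congr rfl root_norm]; simp
    _ ≤ Fintype.card ι := by exact_mod_cast hcard

lemma AVal_ne_zero : AVal ≠ 0 := Complex.exp_ne_zero _

lemma AVal_eq_exp_mul_I : AVal = Complex.exp ((3 * Real.pi / 20 : ℝ) * Complex.I) := by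
  unfold AVal
  congr 1
  push_cast
  ring

lemma norm_AVal : ‖AVal‖ = 1 := by
  rw [AVal_eq_exp_mul_I, Complex.norm_exp_ofReal_mul_I]

lemma AVal_pow_four :
    AVal ^ 4 = Real.cos (3 * (Real.pi / 5)) + Real.sin (3 * (Real.pi / 5)) * Complex.I := by
  rw [AVal_eq_exp_mul_I, ← Complex.exp_nat_mul, Complex.ofReal_cos, Complex.ofReal_sin,
    ← Complex.exp_mul_I]
  congr 1
  push_cast
  ring

lemma AVal_inv_pow_four :
    AVal⁻¹ ^ 4 = Real.cos (3 * (Real.pi / 5)) - Real.sin (3 * (Real.pi / 5)) * Complex.I := by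
  rw [inv_pow, AVal_pow_four, inv_eq_iff_eq_inv, eq_comm, inv_eq_iff_eq_inv, eq_comm]
  apply inv_eq_of_mul_eq_one_left
  have h : (Real.sin (3 * (Real.pi / 5)) : ℂ) ^ 2 + (Real.cos (3 * (Real.pi / 5)) : ℂ) ^ 2 = 1 := by
    exact_mod_cast Real.sin_sq_add_cos_sq (3 * (Real.pi / 5))
  linear_combination h - (Real.sin (3 * (Real.pi / 5)) : ℂ) ^ 2 * Complex.I_sq

lemma trace_MVal_pow_three :
    (MVal ^ 3).trace = AVal ^ 3 * ((AVal ^ 4 + AVal⁻¹ ^ 4 - 1) ^ 3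
      + 3 * AVal⁻¹ ^ 4 * (1 - (AVal ^ 4 + AVal⁻¹ ^ 4 - 1) ^ 2) + (AVal⁻¹ ^ 4) ^ 3 - 1) := by
  have h := AVal_ne_zero
  unfold MVal
  rw [smul_pow, Matrix.trace_smul, smul_eq_mul]
  congr 1
  simp only [pow_succ (_ : Matrix (Fin 5) (Fin 5) ℂ), pow_zero, one_mul, Matrix.trace,
    Matrix.diag, Matrix.mul_apply, Fin.sum_univ_five]
  simp [zpow_neg]
  field_simp
  ring

lemma cos_three_mul_pi_div_five : Real.cos (3 * (Real.pi / 5)) = (1 - √5) / 4 := by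
  have h5 : √5 ^ 2 = 5 := Real.sq_sqrt (by norm_num)
  rw [Real.cos_three_mul, Real.cos_pi_div_five]
  linear_combination (√5 + 3) / 16 * h5

lemma five_lt_norm_trace_MVal_pow_three : 5 < ‖(MVal ^ 3).trace‖ := by
  rw [trace_MVal_pow_three, norm_mul, norm_pow, norm_AVal, one_pow, one_mul,
    AVal_pow_four, AVal_inv_pow_four]
  have h5 : √5 ^ 2 = 5 := Real.sq_sqrt (by norm_num)
  have h5' : (2.2 : ℝ) < √5 := Real.lt_sqrt_of_sq_lt (by norm_num)
  have hs : 0 < Real.sin (3 * (Real.pi / 5)) :=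
    Real.sin_pos_of_pos_of_lt_pi (by positivity) (by linarith [Real.pi_pos])
  have hsc := Real.sin_sq_add_cos_sq (3 * (Real.pi / 5))
  have hc := cos_three_mul_pi_div_five
  generalize Real.sin (3 * (Real.pi / 5)) = s at *
  generalize Real.cos (3 * (Real.pi / 5)) = c at *
  refine lt_of_lt_of_le ?_ ((le_abs_self _).trans (Complex.abs_im_le_norm _))
  have hs2 : s ^ 2 = (5 + √5) / 8 := by
    rw [hc] at hsc
    linear_combination hsc - h5 / 16
  have him : ((c + s * Complex.I + (c - s * Complex.I) - 1 : ℂ) ^ 3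
      + 3 * (c - s * Complex.I) * (1 - (c + s * Complex.I + (c - s * Complex.I) - 1) ^ 2)
      + (c - s * Complex.I) ^ 3 - 1).im = s * (1 + 2 * √5) := by
    simp [pow_succ]
    rw [hc]
    linear_combination s * hs2 + 9 / 16 * s * h5
  rw [him]
  refine lt_of_pow_lt_pow_left₀ 2 (by positivity) ?_
  rw [mul_pow, hs2]
  nlinarith

/-- With `A = exp(2πi·3/40)`, the matrix `M` above satisfies `Mⁿ ≠ I₅`
for every integer `n ≥ 1`: `M` has infinite order in `GL₅(ℂ)`. -/
theorem stmt_12 : ∀ n : ℕ, 1 ≤ n → MVal ^ n ≠ (1 : Matrix (Fin 5) (Fin 5) ℂ) := by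
  intro n hn hM
  have hM3 : (MVal ^ 3) ^ n = 1 := by rw [pow_right_comm, hM, one_pow]
  have hle := Matrix.norm_trace_le_card_of_pow_eq_one (Nat.one_le_iff_ne_zero.mp hn) hM3
  have hlt := five_lt_norm_trace_MVal_pow_three
  rw [Fintype.card_fin] at hle
  norm_num at hle
  linarith
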